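/- Let n ≥ 2 and a₁, …, aₙ ∈ ℝ with aₙ ≠ 0, and consider the loop on ℝ³ with multiplication (x₁,y₁,z₁) ∗ (x₂,y₂,z₂) = (x₁+x₂, y₁+y₂ − x₂·a₁x₁ + (x₂²/2!)·a₂x₁² + ⋯ + ((−1)ⁿ x₂ⁿ/n!)·aₙx₁ⁿ, z₁+z₂). Then the subgroup of the permutation group of ℝ³ generated by all left translations λ_a : x ↦ a ∗ x and all right translations ρ_a : x ↦ x ∗ a, a ∈ ℝ³, is a nilpotent group. -/

import Mathlib

open Finset

/-- The loop multiplication on `ℝ³` with `vᵢ(x) = aᵢxⁱ`: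
`(x₁,y₁,z₁) ∗ (x₂,y₂,z₂) =
 (x₁+x₂, y₁+y₂ + Σ_{i=1}^{n} ((−1)^i x₂^i / i!)·aᵢx₁^i, z₁+z₂)`. -/
noncomputable def loopMul (n : ℕ) (a : ℕ → ℝ) (p q : ℝ × ℝ × ℝ) : ℝ × ℝ × ℝ :=
  (p.1 + q.1,
    p.2.1 + q.2.1 +
      ∑ i ∈ Icc 1 n, ((-1) ^ i * q.1 ^ i / (Nat.factorial i : ℝ)) * (a i * p.1 ^ i),
    p.2.2 + q.2.2)

open Polynomial in
/-- The forward difference of a polynomial lowers its degree. -/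
theorem taylor_sub_self_mem_degreeLT {R : Type*} [CommRing R] {d : ℕ} {f : R[X]}
    (hf : f ∈ degreeLT R (d + 1)) (s : R) : taylor s f - f ∈ degreeLT R d := by
  rw [mem_degreeLT] at hf ⊢
  rcases eq_or_ne f 0 with rfl | h0
  · simp
  have hlt : (taylor s f - f).degree < f.degree :=
    degree_sub_lt_right (degree_taylor f s) h0 (leadingCoeff_taylor s f)
  refine hlt.trans_le ?_
  rw [degree_eq_natDegree h0] at hf ⊢
  exact_mod_cast Nat.lt_succ_iff.1 (by exact_mod_cast hf)

open Polynomial in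
/-- The permutations `(x, y, z) ↦ (x + s, y + f(x), z + t)` of `R³` with `f` a polynomial of
degree less than `d`, where moreover `s = t = 0` if `d ≤ N`. -/
def polynomialShear (R : Type*) [CommRing R] (N d : ℕ) : Subgroup (Equiv.Perm (R × R × R)) where
  carrier := {σ | ∃ s t : R, ∃ f ∈ degreeLT R d, (d ≤ N → s = 0 ∧ t = 0) ∧
    ∀ p, σ p = (p.1 + s, p.2.1 + f.eval p.1, p.2.2 + t)}
  one_mem' := ⟨0, 0, 0, zero_mem _, by simp, by simp⟩
  mul_mem' := by
    rintro σ τ ⟨s, t, f, hf, h0, hσ⟩ ⟨s', t', f', hf', h0', hτ⟩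
    refine ⟨s' + s, t' + t, f' + taylor s' f, add_mem hf' (taylor_mem_degreeLT.2 hf),
      fun hd => by simp [h0 hd, h0' hd], fun p => ?_⟩
    simp [hσ, hτ, taylor_eval, add_assoc]
  inv_mem' := by
    rintro σ ⟨s, t, f, hf, h0, hσ⟩
    refine ⟨-s, -t, -taylor (-s) f, neg_mem (taylor_mem_degreeLT.2 hf),
      fun hd => by simp [h0 hd], fun p => ?_⟩
    rw [Equiv.Perm.inv_eq_iff_eq, hσ]
    simp [taylor_eval]

open Polynomial in
theorem mem_polynomialShear {R : Type*} [CommRing R] {N d : ℕ} {σ : Equiv.Perm (R × R × R)} :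
    σ ∈ polynomialShear R N d ↔ ∃ s t : R, ∃ f ∈ degreeLT R d, (d ≤ N → s = 0 ∧ t = 0) ∧
      ∀ p, σ p = (p.1 + s, p.2.1 + f.eval p.1, p.2.2 + t) :=
  Iff.rfl

theorem polynomialShear_zero (R : Type*) [CommRing R] (N : ℕ) : polynomialShear R N 0 = ⊥ := by
  rw [eq_bot_iff]
  rintro σ ⟨s, t, f, hf, h0, hσ⟩
  obtain ⟨rfl, rfl⟩ := h0 N.zero_le
  obtain rfl : f = 0 := by simpa [Polynomial.mem_degreeLT, Polynomial.degree_eq_bot] using hf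
  exact Subgroup.mem_bot.2 (Equiv.ext fun p => by simp [hσ])

theorem polynomialShear_le {R : Type*} [CommRing R] {N d : ℕ} (h : N + 1 ≤ d) :
    polynomialShear R N (N + 1) ≤ polynomialShear R N d := by
  rintro σ ⟨s, t, f, hf, -, hσ⟩
  exact ⟨s, t, f, Polynomial.degreeLT_mono h hf, fun hd => by omega, hσ⟩

open Polynomial commutatorElement in
theorem commutator_mem_polynomialShear {R : Type*} [CommRing R] {N d : ℕ} (hd : d ≤ N)
    {σ τ : Equiv.Perm (R × R × R)} (hσ : σ ∈ polynomialShear R N (d + 1))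
    (hτ : τ ∈ polynomialShear R N (N + 1)) : ⁅σ, τ⁆ ∈ polynomialShear R N d := by
  obtain ⟨s, t, f, hf, h0, hσ⟩ := hσ
  obtain ⟨s', t', f', hf', -, hτ⟩ := hτ
  have hdiff : f' - taylor s f' ∈ degreeLT R d := by
    rcases hd.lt_or_eq with hlt | rfl
    · simp [(h0 hlt).1]
    · rw [← neg_sub]
      exact neg_mem (taylor_sub_self_mem_degreeLT hf' s)
  refine ⟨0, 0, taylor (-(s + s')) ((f' - taylor s f') + (taylor s' f - f)),
    taylor_mem_degreeLT.2 (add_mem hdiff (taylor_sub_self_mem_degreeLT hf s')),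
    fun _ => ⟨rfl, rfl⟩, fun p => ?_⟩
  obtain ⟨q, rfl⟩ := (τ * σ).surjective p
  have hcomm : ⁅σ, τ⁆ ((τ * σ) q) = (σ * τ) q := by
    simp [commutatorElement_def]
  rw [hcomm]
  ext
  · simp [hσ, hτ]; ring
  · have hx : q.1 + s + s' + (-s' + -s) = q.1 := by ring
    simp [hσ, hτ, taylor_eval, hx]; ring
  · simp [hσ, hτ]; ring

open commutatorElement in
/-- Groups of permutations of the form `(x, y, z) ↦ (x + s, y + f(x), z + t)` with `f` polynomial
of bounded degree are nilpotent. -/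
theorem isNilpotent_of_le_polynomialShear {R : Type*} [CommRing R] {N : ℕ}
    {G : Subgroup (Equiv.Perm (R × R × R))} (hG : G ≤ polynomialShear R N (N + 1)) :
    Group.IsNilpotent G := by
  rw [Subgroup.nilpotent_iff_finite_ascending_central_series]
  refine ⟨N + 1, fun d => (polynomialShear R N d).subgroupOf G, ⟨?_, fun σ d hσ τ => ?_⟩,
    Subgroup.subgroupOf_eq_top.2 hG⟩
  · simp [polynomialShear_zero]
  · rw [Subgroup.mem_subgroupOf] at hσ ⊢
    rcases le_or_gt d N with hd | hd
    · exact commutator_mem_polynomialShear hd hσ (hG τ.2)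
    · exact polynomialShear_le hd (hG ⁅σ, τ⁆.2)

open Polynomial in
theorem C_add_sum_mem_degreeLT {R : Type*} [CommRing R] (n : ℕ) (b : R) (c : ℕ → R) :
    C b + ∑ i ∈ Icc 1 n, C (c i) * X ^ i ∈ degreeLT R (n + 1) := by
  refine add_mem (mem_degreeLT.2 (degree_C_le.trans_lt (by exact_mod_cast n.succ_pos)))
    (sum_mem fun i hi => mem_degreeLT.2 ((degree_C_mul_X_pow_le i _).trans_lt ?_))
  exact_mod_cast Nat.lt_succ_of_le (mem_Icc.1 hi).2

/-- For `n ≥ 2` and `a₁, …, aₙ ∈ ℝ` with `aₙ ≠ 0`, the multiplication group of the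
above loop, i.e. the subgroup of the permutation group of `ℝ³` generated by all left
translations `λ_a : x ↦ a ∗ x` and all right translations `ρ_a : x ↦ x ∗ a`, is a
nilpotent group. -/
theorem multiplication_group_nilpotent (n : ℕ) (hn : 2 ≤ n) (a : ℕ → ℝ)
    (han : a n ≠ 0) :
    Group.IsNilpotent
      ↥(Subgroup.closure {σ : Equiv.Perm (ℝ × ℝ × ℝ) |
        ∃ p : ℝ × ℝ × ℝ,
          (∀ x, σ x = loopMul n a p x) ∨ (∀ x, σ x = loopMul n a x p)}) := by
  refine isNilpotent_of_le_polynomialShear (N := n) ((Subgroup.closure_le _).2 ?_)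
  rintro σ ⟨p, hσ | hσ⟩
  · refine mem_polynomialShear.2 ⟨p.1, p.2.2, _, C_add_sum_mem_degreeLT n p.2.1
      fun i => (-1) ^ i / (Nat.factorial i : ℝ) * (a i * p.1 ^ i), fun h => by omega, fun q => ?_⟩
    rw [hσ]
    ext
    · simp [loopMul, add_comm]
    · simp only [loopMul, Polynomial.eval_add, Polynomial.eval_C, Polynomial.eval_finsetSum,
        Polynomial.eval_mul, Polynomial.eval_pow, Polynomial.eval_X]
      rw [← add_assoc, add_comm q.2.1]
      exact congrArg _ (sum_congr rfl fun i _ => by ring)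
    · simp [loopMul, add_comm]
  · refine mem_polynomialShear.2 ⟨p.1, p.2.2, _, C_add_sum_mem_degreeLT n p.2.1
      fun i => (-1) ^ i * p.1 ^ i / (Nat.factorial i : ℝ) * a i, fun h => by omega, fun q => ?_⟩
    simp [hσ, loopMul, Polynomial.eval_finsetSum, add_assoc, mul_assoc]
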